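/- Let r ≥ 2 and let d₁,…,d_r be integers with each d_j ≥ 3 and Σ d_j = m + r − 1. Then ∏_{j=1}^{r} d_j! ≤ 3!·(m−2)!. -/

import Mathlib

open Finset

theorem aux_two (a b : ℕ) (ha : 3 ≤ a) (hb : 3 ≤ b) :
    Nat.factorial a * Nat.factorial b ≤ 6 * Nat.factorial (a + b - 3) := by
  induction b, hb using Nat.le_induction with
  | base => simp [Nat.factorial, mul_comm]
  | succ b hb ih =>
    have e : a + (b + 1) - 3 = (a + b - 3) + 1 := by omega
    rw [e, Nat.factorial_succ, Nat.factorial_succ]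
    have h : b + 1 ≤ a + b - 3 + 1 := by omega
    calc _ = (b + 1) * (a.factorial * b.factorial) := by ring
      _ ≤ (a + b - 3 + 1) * (6 * (a + b - 3).factorial) := Nat.mul_le_mul h ih
      _ = _ := by ring

theorem aux_main (n : ℕ) : ∀ (m : ℕ) (d : Fin (n + 2) → ℕ), (∀ j, 3 ≤ d j) →
    ∑ j, d j = m + n + 3 →
    2 ≤ m ∧ (∏ j, Nat.factorial (d j)) ≤ 6 * Nat.factorial m := by
  induction n with
  | zero =>
    intro m d hd hs
    rw [Fin.sum_univ_two] at hs
    rw [Fin.prod_univ_two]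
    have h := aux_two (d 0) (d 1) (hd 0) (hd 1)
    have h0 := hd 0
    have h1 := hd 1
    have e : d 0 + d 1 - 3 = m := by omega
    rw [e] at h
    exact ⟨by omega, h⟩
  | succ n ih =>
    intro m d hd hs
    rw [Fin.sum_univ_succ] at hs
    rw [Fin.prod_univ_succ]
    have hc : (n + 2) * 3 ≤ ∑ j : Fin (n + 2), d j.succ := by
      have := Finset.card_nsmul_le_sum (Finset.univ : Finset (Fin (n + 2)))
        (fun j => d j.succ) 3 (fun j _ => hd _)
      simpa using this
    obtain ⟨k, hk⟩ : ∃ k, ∑ j : Fin (n + 2), d j.succ = k + n + 3 :=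
      ⟨(∑ j : Fin (n + 2), d j.succ) - (n + 3), by omega⟩
    obtain ⟨-, h2⟩ := ih k (fun j => d j.succ) (fun j => hd _) hk
    have h0 := hd 0
    have h3 := aux_two (d 0) k h0 (by omega)
    obtain ⟨p, hp⟩ : ∃ p, m = p + 2 := ⟨m - 2, by omega⟩
    have e : d 0 + k - 3 = p := by omega
    rw [e] at h3
    refine ⟨by omega, ?_⟩
    have hp2 : 2 ≤ p := by omega
    rw [hp, Nat.factorial_succ, Nat.factorial_succ]
    calc _ ≤ (d 0).factorial * (6 * k.factorial) := Nat.mul_le_mul_left _ h2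
      _ = 6 * ((d 0).factorial * k.factorial) := by ring
      _ ≤ 6 * (6 * p.factorial) := Nat.mul_le_mul_left _ h3
      _ ≤ 6 * (((p + 1 + 1) * (p + 1)) * p.factorial) := by
          gcongr
          nlinarith
      _ = _ := by ring

/-- If r ≥ 2 and d₁,…,d_r ≥ 3 with Σ d_j = m + r − 1, then ∏ d_j! ≤ 3!·(m−2)!. -/
theorem factorial_product_bound_no_quadric (m r : ℕ) (hr : 2 ≤ r) (d : Fin r → ℕ)
    (hd : ∀ j, 3 ≤ d j) (hsum : ∑ j, d j = m + r - 1) :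
    (∏ j, Nat.factorial (d j)) ≤ Nat.factorial 3 * Nat.factorial (m - 2) := by
  obtain ⟨n, rfl⟩ : ∃ n, r = n + 2 := ⟨r - 2, by omega⟩
  have hc : (n + 2) * 3 ≤ ∑ j : Fin (n + 2), d j := by
    have := Finset.card_nsmul_le_sum (Finset.univ : Finset (Fin (n + 2)))
      (fun j => d j) 3 (fun j _ => hd _)
    simpa using this
  exact (aux_main n (m - 2) d hd (by omega)).2
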